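/- arXiv:1511.06177 — 3 statements merged into one kernel-verified Lean document; each statement's English description precedes it below -/
import Mathlib

section
/- For every complex number q with |q| < 1, φ(q)^3 = φ(q^4)^3 + 6q·φ(q^4)·ψ(q^4)^2 + 12q^2·ψ(q^4)^2·ψ(q^8) + 8q^3·ψ(q^8)^3. -/
/-- Ramanujan's theta function `φ(q) = ∑_{n=-∞}^{∞} q^(n^2)`. -/
noncomputable def phi (q : ℂ) : ℂ := ∑' n : ℤ, q ^ (n ^ 2)

/-- Ramanujan's theta function `ψ(q) = ∑_{n=0}^{∞} q^(n(n+1)/2)`. -/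
noncomputable def psi (q : ℂ) : ℂ := ∑' n : ℕ, q ^ (n * (n + 1) / 2)


lemma hasSum_int_even_odd {f : ℤ → ℂ} {a b : ℂ} (he : HasSum (fun k : ℤ => f (2 * k)) a)
    (ho : HasSum (fun k : ℤ => f (2 * k + 1)) b) : HasSum f (a + b) := by
  have hf : Function.Injective (fun k : ℤ => 2 * k) := fun x y h => by
    simp only at h; omega
  have hg : Function.Injective (fun k : ℤ => 2 * k + 1) := fun x y h => by
    simp only at h; omega
  have hc : IsCompl (Set.range (fun k : ℤ => 2 * k)) (Set.range (fun k : ℤ => 2 * k + 1)) := by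
    rw [isCompl_iff, Set.disjoint_iff_forall_ne, codisjoint_iff]
    constructor
    · rintro _ ⟨a, rfl⟩ _ ⟨c, rfl⟩ h
      simp only at h
      omega
    · refine Set.eq_univ_iff_forall.2 ?_
      intro m
      rcases Int.even_or_odd' m with ⟨b, hb | hb⟩
      · left; exact ⟨b, hb.symm⟩
      · right; exact ⟨b, hb.symm⟩
  exact HasSum.add_isCompl hc (hf.hasSum_range_iff.2 he) (hg.hasSum_range_iff.2 ho)

/-- The bilateral version of `psi`. -/
noncomputable def tri (q : ℂ) : ℂ := ∑' n : ℤ, q ^ (n * (n + 1) / 2)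

lemma tri_nat (q : ℂ) (n : ℕ) :
    q ^ ((n : ℤ) * ((n : ℤ) + 1) / 2) = q ^ (n * (n + 1) / 2) := by
  rw [← zpow_natCast]; push_cast; rfl

lemma tri_neg (n : ℤ) : (-(n + 1)) * (-(n + 1) + 1) / 2 = n * (n + 1) / 2 := by
  congr 1; ring

lemma summable_norm_psi (q : ℂ) (hq : ‖q‖ < 1) :
    Summable (fun n : ℕ => ‖q ^ (n * (n + 1) / 2)‖) := by
  refine Summable.of_nonneg_of_le (fun _ => norm_nonneg _) (fun n => ?_)
    (summable_geometric_of_lt_one (norm_nonneg q) hq)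
  rw [norm_pow]
  apply pow_le_pow_of_le_one (norm_nonneg q) hq.le
  rw [Nat.le_div_iff_mul_le (by norm_num)]
  rcases n with _ | n
  · simp
  · nlinarith

lemma summable_norm_tri (q : ℂ) (hq : ‖q‖ < 1) :
    Summable (fun n : ℤ => ‖q ^ (n * (n + 1) / 2)‖) := by
  refine Summable.of_nat_of_neg_add_one ?_ ?_
  · simp_rw [tri_nat]; exact summable_norm_psi q hq
  · simp_rw [tri_neg, tri_nat]; exact summable_norm_psi q hq

lemma tri_eq (q : ℂ) (hq : ‖q‖ < 1) : tri q = 2 * psi q := by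
  have h : HasSum (fun n : ℕ => q ^ (n * (n + 1) / 2)) (psi q) :=
    (summable_norm_psi q hq).of_norm.hasSum
  have h1 : HasSum (fun n : ℤ => q ^ (n * (n + 1) / 2)) (psi q + psi q) := by
    refine HasSum.of_nat_of_neg_add_one ?_ ?_
    · simp_rw [tri_nat]; exact h
    · simp_rw [tri_neg, tri_nat]; exact h
  rw [tri, h1.tsum_eq]; ring

lemma summable_norm_phi (q : ℂ) (hq : ‖q‖ < 1) :
    Summable (fun n : ℤ => ‖q ^ (n ^ 2)‖) := by
  have key : Summable (fun n : ℕ => ‖q ^ ((n : ℤ) ^ 2)‖) := by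
    refine Summable.of_nonneg_of_le (fun _ => norm_nonneg _) (fun n => ?_)
      (summable_geometric_of_lt_one (norm_nonneg q) hq)
    have : q ^ ((n : ℤ) ^ 2) = q ^ (n ^ 2) := by
      rw [← zpow_natCast]; push_cast; rfl
    rw [this, norm_pow]
    apply pow_le_pow_of_le_one (norm_nonneg q) hq.le
    nlinarith [Nat.le_self_pow (n := 2) (by norm_num) n]
  refine Summable.of_nat_of_neg key ?_
  simpa using key

lemma phi_split (q : ℂ) (h0 : q ≠ 0) (hq : ‖q‖ < 1) :
    phi q = phi (q ^ 4) + q * tri (q ^ 8) := by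
  have h4 : ‖q ^ 4‖ < 1 := by rw [norm_pow]; exact pow_lt_one₀ (norm_nonneg _) hq (by norm_num)
  have h8 : ‖q ^ 8‖ < 1 := by rw [norm_pow]; exact pow_lt_one₀ (norm_nonneg _) hq (by norm_num)
  have he : HasSum (fun n : ℤ => (q ^ 4) ^ (n ^ 2)) (phi (q ^ 4)) :=
    (summable_norm_phi _ h4).of_norm.hasSum
  have ho : HasSum (fun n : ℤ => q * (q ^ 8) ^ (n * (n + 1) / 2)) (q * tri (q ^ 8)) :=
    (summable_norm_tri _ h8).of_norm.hasSum.mul_left q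
  have : HasSum (fun n : ℤ => q ^ (n ^ 2)) (phi (q ^ 4) + q * tri (q ^ 8)) := by
    refine hasSum_int_even_odd ?_ ?_
    · convert he using 2 with n
      rw [← zpow_natCast, ← zpow_mul]; congr 1; push_cast; ring
    · convert ho using 2 with n
      obtain ⟨k, hk⟩ := Int.even_mul_succ_self n
      have : n * (n + 1) / 2 = k := by omega
      rw [this, ← zpow_natCast, ← zpow_mul, ← zpow_one_add₀ h0]; congr 1
      push_cast; linear_combination 4 * hk
  exact this.tsum_eq

lemma tri_term_one (q : ℂ) (h0 : q ≠ 0) (a b : ℤ) :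
    q ^ ((b + a) * ((b + a) + 1) / 2) * q ^ ((b - a) * ((b - a) + 1) / 2) =
      q ^ (a ^ 2) * (q ^ 2) ^ (b * (b + 1) / 2) := by
  obtain ⟨k, hk⟩ := Int.even_mul_succ_self b
  obtain ⟨l, hl⟩ := Int.even_mul_succ_self (b + a)
  obtain ⟨m, hm⟩ := Int.even_mul_succ_self (b - a)
  rw [hk, hl, hm, ← two_mul, ← two_mul, ← two_mul, Int.mul_ediv_cancel_left _ two_ne_zero,
    Int.mul_ediv_cancel_left _ two_ne_zero, Int.mul_ediv_cancel_left _ two_ne_zero,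
    ← zpow_natCast, ← zpow_mul, ← zpow_add₀ h0, ← zpow_add₀ h0]
  congr 1
  push_cast
  have : 2 * (l + m) = 2 * (a ^ 2 + 2 * k) := by linear_combination 2 * hk - hl - hm
  exact mul_left_cancel₀ two_ne_zero this

lemma tri_term_two (q : ℂ) (h0 : q ≠ 0) (a b : ℤ) :
    q ^ ((b + a) * ((b + a) + 1) / 2) * q ^ ((a - b - 1) * ((a - b - 1) + 1) / 2) =
      q ^ (a ^ 2) * (q ^ 2) ^ (b * (b + 1) / 2) := by
  obtain ⟨k, hk⟩ := Int.even_mul_succ_self b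
  obtain ⟨l, hl⟩ := Int.even_mul_succ_self (b + a)
  obtain ⟨m, hm⟩ := Int.even_mul_succ_self (a - b - 1)
  rw [hk, hl, hm, ← two_mul, ← two_mul, ← two_mul, Int.mul_ediv_cancel_left _ two_ne_zero,
    Int.mul_ediv_cancel_left _ two_ne_zero, Int.mul_ediv_cancel_left _ two_ne_zero,
    ← zpow_natCast, ← zpow_mul, ← zpow_add₀ h0, ← zpow_add₀ h0]
  congr 1
  push_cast
  have : 2 * (l + m) = 2 * (a ^ 2 + 2 * k) := by linear_combination 2 * hk - hl - hm
  exact mul_left_cancel₀ two_ne_zero this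

lemma hasSum_of_eq {f g : ℤ × ℤ → ℂ} {a : ℂ} (h : HasSum g a) (e : ∀ p, f p = g p) :
    HasSum f a := by
  rwa [funext e]

def triF (p : ℤ × ℤ) : ℤ × ℤ := (p.2 + p.1, p.2 - p.1)

def triG (p : ℤ × ℤ) : ℤ × ℤ := (p.2 + p.1, p.1 - p.2 - 1)

lemma triF_inj : Function.Injective triF := by
  rintro ⟨a, b⟩ ⟨c, d⟩ h
  simp only [triF, Prod.mk.injEq] at h ⊢
  omega

lemma triG_inj : Function.Injective triG := by
  rintro ⟨a, b⟩ ⟨c, d⟩ h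
  simp only [triG, Prod.mk.injEq] at h ⊢
  omega

lemma triC : IsCompl (Set.range triF) (Set.range triG) := by
  rw [isCompl_iff, Set.disjoint_iff_forall_ne, codisjoint_iff]
  constructor
  · rintro _ ⟨⟨a, b⟩, rfl⟩ _ ⟨⟨c, d⟩, rfl⟩ h
    simp only [triF, triG, Prod.mk.injEq] at h
    omega
  · refine Set.eq_univ_iff_forall.2 ?_
    rintro ⟨m, n⟩
    rcases Int.even_or_odd' (m + n) with ⟨b, hb | hb⟩
    · left; refine ⟨(m - b, b), ?_⟩
      simp only [triF, Prod.mk.injEq]; omega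
    · right; refine ⟨(b + 1, m - b - 1), ?_⟩
      simp only [triG, Prod.mk.injEq]; omega

lemma hasSum_prod_aux {f g : ℤ → ℂ} (hf : Summable fun n => ‖f n‖)
    (hg : Summable fun n => ‖g n‖) :
    HasSum (fun p : ℤ × ℤ => f p.1 * g p.2) ((∑' n, f n) * ∑' n, g n) :=
  hf.of_norm.hasSum.mul hg.of_norm.hasSum (summable_mul_of_summable_norm hf hg)

lemma hasSum_compl_aux {F : ℤ × ℤ → ℂ} {a b : ℂ} (hf : HasSum (fun p => F (triF p)) a)
    (hg : HasSum (fun p => F (triG p)) b) : HasSum F (a + b) :=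
  HasSum.add_isCompl triC (triF_inj.hasSum_range_iff.2 hf) (triG_inj.hasSum_range_iff.2 hg)

lemma tri_sq (q : ℂ) (h0 : q ≠ 0) (hq : ‖q‖ < 1) :
    tri q ^ 2 = 2 * (phi q * tri (q ^ 2)) := by
  have h2 : ‖q ^ 2‖ < 1 := by rw [norm_pow]; exact pow_lt_one₀ (norm_nonneg _) hq (by norm_num)
  have hL := hasSum_prod_aux (summable_norm_tri q hq) (summable_norm_tri q hq)
  have hR := hasSum_prod_aux (summable_norm_phi q hq) (summable_norm_tri _ h2)
  rw [← tri] at hL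
  rw [← tri, ← phi] at hR
  have hS : HasSum (fun p : ℤ × ℤ => q ^ (p.1 * (p.1 + 1) / 2) * q ^ (p.2 * (p.2 + 1) / 2))
      (phi q * tri (q ^ 2) + phi q * tri (q ^ 2)) := by
    refine hasSum_compl_aux ?_ ?_
    · refine hasSum_of_eq hR fun p => ?_
      simp only [triF]
      rw [tri_term_one q h0 p.1 p.2]
    · refine hasSum_of_eq hR fun p => ?_
      simp only [triG]
      rw [tri_term_two q h0 p.1 p.2]
  rw [sq, hL.unique hS]; ring

theorem stmt1 (q : ℂ) (hq : ‖q‖ < 1) :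
    phi q ^ 3 = phi (q ^ 4) ^ 3 + 6 * q * phi (q ^ 4) * psi (q ^ 4) ^ 2
      + 12 * q ^ 2 * psi (q ^ 4) ^ 2 * psi (q ^ 8) + 8 * q ^ 3 * psi (q ^ 8) ^ 3 := by
  by_cases h0 : q = 0
  · subst h0; simp
  have h4 : ‖q ^ 4‖ < 1 := by rw [norm_pow]; exact pow_lt_one₀ (norm_nonneg _) hq (by norm_num)
  have h8 : ‖q ^ 8‖ < 1 := by rw [norm_pow]; exact pow_lt_one₀ (norm_nonneg _) hq (by norm_num)
  have e1 := phi_split q h0 hq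
  have e2 := tri_sq (q ^ 4) (pow_ne_zero _ h0) h4
  rw [← pow_mul, show 4 * 2 = 8 from rfl, tri_eq _ h4, tri_eq _ h8] at e2
  rw [tri_eq _ h8] at e1
  have e3 : psi (q ^ 4) ^ 2 = phi (q ^ 4) * psi (q ^ 8) := by linear_combination e2 / 4
  rw [e1, e3]; ring
end

section
/- For every complex number q with |q| < 1, φ(q)·φ(q^3) = φ(q^16)·φ(q^48) + 4q^16·ψ(q^32)·ψ(q^96) + 2q·φ(q^48)·ψ(q^8) + 2q^3·φ(q^16)·ψ(q^24) + 6q^4·ψ(q^8)·ψ(q^24) + 4q^13·ψ(q^8)·ψ(q^96) + 4q^7·ψ(q^24)·ψ(q^32). -/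
theorem split_hasSum {A B C : Type*} {g : A → C} {h : B → C} {f : C → ℂ} {a b : ℂ}
    (hb : Function.Bijective (Sum.elim g h)) (h1 : HasSum (fun x => f (g x)) a)
    (h2 : HasSum (fun x => f (h x)) b) : HasSum f (a + b) := by
  refine (Equiv.ofBijective _ hb).hasSum_iff.mp ?_
  exact HasSum.sum (f := f ∘ Sum.elim g h) h1 h2

theorem HasSum.congr_fun_aux {A : Type*} {f g : A → ℂ} {a : ℂ} (h : HasSum f a)
    (e : ∀ n, g n = f n) : HasSum g a := by
  rwa [funext e]

theorem summ_norm (q : ℂ) (hq : ‖q‖ < 1) (h0 : q ≠ 0) (e : ℤ → ℤ) (he : ∀ n, |n| ≤ e n + 1) :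
    Summable (fun n => ‖q ^ (e n)‖) := by
  have hpos : 0 < ‖q‖ := norm_pos_iff.mpr h0
  have hg : Summable (fun n : ℕ => ‖q‖ ^ ((n : ℤ) - 1)) := by
    have := (summable_geometric_of_lt_one hpos.le hq).mul_right (‖q‖⁻¹)
    refine this.congr fun n => ?_
    rw [zpow_sub_one₀ hpos.ne', zpow_natCast]
  have hG : Summable (fun n : ℤ => ‖q‖ ^ (|n| - 1)) := by
    apply Summable.of_nat_of_neg
    · simpa using hg
    · simpa using hg
  refine Summable.of_nonneg_of_le (fun n => norm_nonneg _) (fun n => ?_) hG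
  rw [norm_zpow]
  exact zpow_le_zpow_right_of_le_one₀ hpos hq.le (by linarith [he n])

theorem abs_le_sq_int (n : ℤ) : |n| ≤ n ^ 2 := by
  rw [← sq_abs]
  rcases (abs_nonneg n).eq_or_lt with h | h
  · rw [← h]; norm_num
  · nlinarith

theorem abs_le_tri (n : ℤ) : |n| ≤ n * (n + 1) + 1 := by
  rcases abs_cases n with ⟨h, _⟩ | ⟨h, _⟩ <;> rw [h] <;> nlinarith [sq_nonneg (n + 1)]

theorem tri_nonneg (n : ℤ) : 0 ≤ n * (n + 1) := by
  rcases le_or_gt 0 n with h | h <;> nlinarith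

/-- the sum of `q ^ (a n^2)` over the integers -/
noncomputable def TT (q : ℂ) (a : ℤ) : ℂ := ∑' n : ℤ, q ^ (a * n ^ 2)

/-- the sum of `q ^ (a n (n+1))` over the integers -/
noncomputable def SS (q : ℂ) (a : ℤ) : ℂ := ∑' n : ℤ, q ^ (a * (n * (n + 1)))

section
variable {q : ℂ}

theorem TT_norm (hq : ‖q‖ < 1) (h0 : q ≠ 0) {a : ℤ} (ha : 1 ≤ a) :
    Summable (fun n : ℤ => ‖q ^ (a * n ^ 2)‖) :=
  summ_norm q hq h0 _ fun n => by nlinarith [abs_le_sq_int n, sq_nonneg n]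

theorem SS_norm (hq : ‖q‖ < 1) (h0 : q ≠ 0) {a : ℤ} (ha : 1 ≤ a) :
    Summable (fun n : ℤ => ‖q ^ (a * (n * (n + 1)))‖) :=
  summ_norm q hq h0 _ fun n => by nlinarith [abs_le_tri n, tri_nonneg n]

theorem TT_split (hq : ‖q‖ < 1) (h0 : q ≠ 0) {a : ℤ} (ha : 1 ≤ a) :
    TT q a = TT q (4 * a) + q ^ a * SS q (4 * a) := by
  refine HasSum.tsum_eq (split_hasSum (g := fun n : ℤ => 2 * n) (h := fun n : ℤ => 2 * n + 1)
    ?_ ?_ ?_)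
  · constructor
    · rintro (x | x) (y | y) h <;> simp at h ⊢ <;> omega
    · intro x
      rcases Int.even_or_odd' x with ⟨k, h | h⟩
      · exact ⟨.inl k, h.symm⟩
      · exact ⟨.inr k, h.symm⟩
  · refine (TT_norm hq h0 (a := 4 * a) (by linarith)).of_norm.hasSum.congr_fun_aux fun n => ?_
    ring_nf
  · refine ((SS_norm hq h0 (a := 4 * a) (by linarith)).of_norm.hasSum.mul_left
      (q ^ a)).congr_fun_aux fun n => ?_
    rw [← zpow_add₀ h0]
    ring_nf

theorem phi_eq (k : ℕ) : phi (q ^ k) = TT q k := by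
  unfold phi TT
  congr 1; ext n
  rw [zpow_mul, zpow_natCast]

theorem psi_eq (hq : ‖q‖ < 1) (h0 : q ≠ 0) (k : ℕ) (hk : 1 ≤ k) :
    2 * psi (q ^ (2 * k)) = SS q k := by
  have hs := (SS_norm hq h0 (a := k) (by exact_mod_cast hk)).of_norm
  have h1 : Summable (fun n : ℕ => q ^ ((k : ℤ) * ((n : ℤ) * (n + 1)))) :=
    hs.comp_injective Nat.cast_injective
  have h2 : Summable (fun n : ℕ => q ^ ((k : ℤ) * (-((n : ℤ) + 1) * (-((n : ℤ) + 1) + 1)))) :=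
    hs.comp_injective (i := fun n : ℕ => -((n : ℤ) + 1)) fun a b h => by simpa using h
  unfold SS
  rw [tsum_of_nat_of_neg_add_one (f := fun n : ℤ => q ^ ((k : ℤ) * (n * (n + 1)))) h1 h2, two_mul]
  have key : ∀ n : ℕ, (q ^ (2 * k)) ^ (n * (n + 1) / 2) = q ^ ((k : ℤ) * ((n : ℤ) * (n + 1))) := by
    intro n
    have : 2 * k * (n * (n + 1) / 2) = k * (n * (n + 1)) := by
      rw [mul_comm 2 k, mul_assoc, Nat.mul_div_cancel' (Nat.even_mul_succ_self n).two_dvd]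
    rw [← pow_mul, this, ← zpow_natCast]
    push_cast
    rfl
  congr 1
  · exact tsum_congr key
  · refine tsum_congr fun n => (key n).trans ?_
    congr 1; ring

theorem SS_mul (hq : ‖q‖ < 1) (h0 : q ≠ 0) :
    SS q 4 * SS q 12 = 2 * (TT q 48 * SS q 16 + q ^ 8 * TT q 16 * SS q 48) := by
  have hA : HasSum (fun z : ℤ × ℤ => q ^ (16 * (z.1 * (z.1 + 1))) * q ^ (48 * z.2 ^ 2))
      (SS q 16 * TT q 48) := by
    have h1 := SS_norm hq h0 (a := 16) (by norm_num)
    have h2 := TT_norm hq h0 (a := 48) (by norm_num)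
    unfold SS TT
    rw [tsum_mul_tsum_of_summable_norm h1 h2]
    exact (summable_mul_of_summable_norm h1 h2).hasSum
  have hB : HasSum (fun z : ℤ × ℤ => q ^ 8 * (q ^ (16 * z.1 ^ 2) * q ^ (48 * (z.2 * (z.2 + 1)))))
      (q ^ 8 * (TT q 16 * SS q 48)) := by
    have h1 := TT_norm hq h0 (a := 16) (by norm_num)
    have h2 := SS_norm hq h0 (a := 48) (by norm_num)
    unfold SS TT
    rw [tsum_mul_tsum_of_summable_norm h1 h2]
    exact (summable_mul_of_summable_norm h1 h2).hasSum.mul_left _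
  have e8 : (q ^ 8 : ℂ) = q ^ (8 : ℤ) := by norm_cast
  have hL : SS q 4 * SS q 12 =
      ∑' z : ℤ × ℤ, q ^ (4 * (z.1 * (z.1 + 1))) * q ^ (12 * (z.2 * (z.2 + 1))) :=
    tsum_mul_tsum_of_summable_norm (SS_norm hq h0 (by norm_num)) (SS_norm hq h0 (by norm_num))
  have hS : HasSum (fun z : ℤ × ℤ => q ^ (4 * (z.1 * (z.1 + 1))) * q ^ (12 * (z.2 * (z.2 + 1))))
      ((SS q 16 * TT q 48 + q ^ 8 * (TT q 16 * SS q 48)) +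
        (SS q 16 * TT q 48 + q ^ 8 * (TT q 16 * SS q 48))) := by
    have hAB := HasSum.sum (f := Sum.elim _ _) hA hB
    let g : (ℤ × ℤ) ⊕ (ℤ × ℤ) → ℤ × ℤ :=
      Sum.elim (fun z => (z.1 + 3 * z.2, z.1 - z.2)) (fun z => (z.1 + 3 * z.2 + 1, z.1 - z.2 - 1))
    let h : (ℤ × ℤ) ⊕ (ℤ × ℤ) → ℤ × ℤ :=
      Sum.elim (fun z => (z.1 + 3 * z.2, - z.1 + z.2 - 1)) (fun z => (z.1 + 3 * z.2 + 1, - z.1 + z.2))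
    refine split_hasSum (g := g) (h := h) ?_ ?_ ?_
    · constructor
      · rintro ((⟨a, b⟩ | ⟨a, b⟩) | (⟨a, b⟩ | ⟨a, b⟩)) ((⟨c, d⟩ | ⟨c, d⟩) | (⟨c, d⟩ | ⟨c, d⟩)) hh <;>
          simp [g, h] at hh ⊢ <;> omega
      · rintro ⟨m, n⟩
        have : (m - n) % 4 = 0 ∨ (m - n) % 4 = 2 ∨ (m + n + 1) % 4 = 0 ∨ (m + n + 1) % 4 = 2 := by
          omega
        rcases this with hh | hh | hh | hh
        · exact ⟨.inl (.inl (n + (m - n) / 4, (m - n) / 4)), by simp [g]; omega⟩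
        · exact ⟨.inl (.inr (n + 1 + (m - n) / 4, (m - n) / 4)), by simp [g]; omega⟩
        · exact ⟨.inr (.inl ((m + n + 1) / 4 - 1 - n, (m + n + 1) / 4)), by simp [h]; omega⟩
        · exact ⟨.inr (.inr ((m + n + 1) / 4 - n, (m + n + 1) / 4)), by simp [h]; omega⟩
    · refine hAB.congr_fun_aux fun z => ?_
      rcases z with ⟨a, b⟩ | ⟨a, b⟩ <;> simp only [g, Sum.elim_inl, Sum.elim_inr, e8] <;>
        simp only [← zpow_add₀ h0] <;> ring_nf
    · refine hAB.congr_fun_aux fun z => ?_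
      rcases z with ⟨a, b⟩ | ⟨a, b⟩ <;> simp only [h, Sum.elim_inl, Sum.elim_inr, e8] <;>
        simp only [← zpow_add₀ h0] <;> ring_nf
  rw [hL, hS.tsum_eq]
  ring

end

theorem stmt2 (q : ℂ) (hq : ‖q‖ < 1) :
    phi q * phi (q ^ 3) = phi (q ^ 16) * phi (q ^ 48) + 4 * q ^ 16 * psi (q ^ 32) * psi (q ^ 96)
      + 2 * q * phi (q ^ 48) * psi (q ^ 8) + 2 * q ^ 3 * phi (q ^ 16) * psi (q ^ 24)
      + 6 * q ^ 4 * psi (q ^ 8) * psi (q ^ 24) + 4 * q ^ 13 * psi (q ^ 8) * psi (q ^ 96)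
      + 4 * q ^ 7 * psi (q ^ 24) * psi (q ^ 32) := by
  by_cases h0 : q = 0
  · subst h0; simp
  have p1 : phi q = TT q 1 := by simpa using phi_eq (q := q) 1
  have p3 : phi (q ^ 3) = TT q 3 := phi_eq 3
  have p16 : phi (q ^ 16) = TT q 16 := phi_eq 16
  have p48 : phi (q ^ 48) = TT q 48 := phi_eq 48
  have s4 : 2 * psi (q ^ 8) = SS q 4 := psi_eq hq h0 4 (by norm_num)
  have s12 : 2 * psi (q ^ 24) = SS q 12 := psi_eq hq h0 12 (by norm_num)
  have s16 : 2 * psi (q ^ 32) = SS q 16 := psi_eq hq h0 16 (by norm_num)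
  have s48 : 2 * psi (q ^ 96) = SS q 48 := psi_eq hq h0 48 (by norm_num)
  have t1 : TT q 1 = TT q 4 + q * SS q 4 := by
    simpa using TT_split hq h0 (a := 1) (by norm_num)
  have t4 : TT q 4 = TT q 16 + q ^ 4 * SS q 16 := TT_split hq h0 (a := 4) (by norm_num)
  have t3 : TT q 3 = TT q 12 + q ^ 3 * SS q 12 := TT_split hq h0 (a := 3) (by norm_num)
  have t12 : TT q 12 = TT q 48 + q ^ 12 * SS q 48 := TT_split hq h0 (a := 12) (by norm_num)
  have key := SS_mul hq h0
  rw [← s4, ← s12, ← s16, ← s48] at key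
  rw [p1, p3, p16, p48, t1, t4, t3, t12, ← s4, ← s12, ← s16, ← s48]
  linear_combination (-q ^ 4 / 2) * key
end

section
/- For every complex number q with |q| < 1, φ(q)^2 = φ(q^8)^2 + 4q^4·ψ(q^16)^2 + 4q^2·ψ(q^8)^2 + 4q·φ(q^16)·ψ(q^8) + 8q^5·ψ(q^8)·ψ(q^32). -/
lemma aux_split {α β γ : Type*} (f : α → ℂ) (hf : Summable f) (i : β → α) (j : γ → α)
    (hi : Function.Injective i) (hj : Function.Injective j)
    (hd : ∀ b c, i b ≠ j c) (hc : ∀ a, (∃ b, i b = a) ∨ ∃ c, j c = a) :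
    ∑' a, f a = ∑' b, f (i b) + ∑' c, f (j c) := by
  have hcompl : IsCompl (Set.range i) (Set.range j) := by
    constructor
    · rw [Set.disjoint_left]
      rintro _ ⟨b, rfl⟩ ⟨c, hc⟩
      exact hd b c hc.symm
    · rw [codisjoint_iff]
      refine Set.eq_univ_of_forall ?_
      intro a
      exact hc a
  have h1 : HasSum (f ∘ ((↑) : Set.range i → α)) (∑' b, f (i b)) :=
    hi.hasSum_range_iff.2 (hf.comp_injective hi).hasSum
  have h2 : HasSum (f ∘ ((↑) : Set.range j → α)) (∑' b, f (j b)) :=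
    hj.hasSum_range_iff.2 (hf.comp_injective hj).hasSum
  exact (h1.add_isCompl hcompl h2).tsum_eq

lemma aux_summable_nat (q : ℂ) (hq : ‖q‖ < 1) : Summable fun n : ℕ => ‖q ^ ((n : ℤ) ^ 2)‖ := by
  refine Summable.of_nonneg_of_le (fun _ => norm_nonneg _) (fun n => ?_)
    (summable_geometric_of_lt_one (norm_nonneg q) hq)
  have : ((n : ℤ) ^ 2) = ((n ^ 2 : ℕ) : ℤ) := by push_cast; rfl
  rw [this, zpow_natCast, norm_pow]
  exact pow_le_pow_of_le_one (norm_nonneg q) hq.le (Nat.le_self_pow two_ne_zero n)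

lemma aux_summable (q : ℂ) (hq : ‖q‖ < 1) : Summable fun n : ℤ => ‖q ^ (n ^ 2)‖ := by
  refine Summable.of_nat_of_neg (aux_summable_nat q hq) ?_
  simpa using aux_summable_nat q hq

lemma aux_summable_tri (q : ℂ) (hq : ‖q‖ < 1) :
    Summable fun n : ℤ => ‖q ^ (n ^ 2 + n)‖ := by
  have h : Summable fun n : ℕ => ‖q ^ ((n : ℤ) ^ 2 + n)‖ := by
    refine Summable.of_nonneg_of_le (fun _ => norm_nonneg _) (fun n => ?_)
      (summable_geometric_of_lt_one (norm_nonneg q) hq)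
    have : ((n : ℤ) ^ 2 + n) = ((n ^ 2 + n : ℕ) : ℤ) := by push_cast; rfl
    rw [this, zpow_natCast, norm_pow]
    exact pow_le_pow_of_le_one (norm_nonneg q) hq.le (Nat.le_add_left _ _)
  refine Summable.of_nat_of_neg_add_one h ?_
  refine h.congr fun n => ?_
  congr 2
  ring

/-- The two-sided version of `psi`. -/
noncomputable def auxT (q : ℂ) : ℂ := ∑' n : ℤ, q ^ (n ^ 2 + n)

lemma auxT_eq (q : ℂ) (hq : ‖q‖ < 1) : auxT q = 2 * psi (q ^ 2) := by
  have hs := (aux_summable_tri q hq).of_norm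
  have e1 : ∀ n : ℕ, q ^ ((n : ℤ) ^ 2 + n) = (q ^ 2) ^ (n * (n + 1) / 2) := by
    intro n
    rw [← pow_mul, Nat.mul_div_cancel' (Nat.even_mul_succ_self n).two_dvd, ← zpow_natCast]
    congr 1
    push_cast
    ring
  have e2 : ∀ n : ℕ, q ^ ((-((n : ℤ) + 1)) ^ 2 + (-((n : ℤ) + 1)))
      = (q ^ 2) ^ (n * (n + 1) / 2) := by
    intro n
    rw [← e1]
    congr 1
    ring
  have i2 : Function.Injective fun n : ℕ => -((n : ℤ) + 1) := fun a b h => by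
    simp only at h; omega
  have h := aux_split _ hs (fun n : ℕ => (n : ℤ)) (fun n : ℕ => -((n : ℤ) + 1))
    Nat.cast_injective i2 (fun b c => by omega) (fun a => by
      rcases lt_or_ge a 0 with h | h
      · exact Or.inr ⟨(-a - 1).toNat, by omega⟩
      · exact Or.inl ⟨a.toNat, by omega⟩)
  simp only [e1, e2] at h
  rw [auxT, h, psi]
  ring

lemma aux_A (q : ℂ) (h0 : q ≠ 0) (hq : ‖q‖ < 1) :
    phi q = phi (q ^ 4) + 2 * q * psi (q ^ 8) := by
  have h4 : ‖q ^ 4‖ < 1 := by rw [norm_pow]; exact pow_lt_one₀ (norm_nonneg q) hq (by norm_num)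
  have hT := auxT_eq (q ^ 4) h4
  have h := aux_split _ (aux_summable q hq).of_norm (fun n : ℤ => 2 * n) (fun n : ℤ => 2 * n + 1)
    (fun a b h => by simp only at h; omega) (fun a b h => by simp only at h; omega)
    (fun b c => by omega) (fun a => by
      rcases Int.even_or_odd' a with ⟨k, h | h⟩
      · exact Or.inl ⟨k, h.symm⟩
      · exact Or.inr ⟨k, h.symm⟩)
  have e1 : ∀ n : ℤ, q ^ ((2 * n) ^ 2) = (q ^ 4) ^ (n ^ 2) := by
    intro n
    rw [← zpow_natCast q 4, ← zpow_mul]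
    congr 1
    push_cast
    ring
  have e2 : ∀ n : ℤ, q ^ ((2 * n + 1) ^ 2) = q * (q ^ 4) ^ (n ^ 2 + n) := by
    intro n
    rw [← zpow_natCast q 4, ← zpow_mul, ← zpow_one_add₀ h0]
    congr 1
    push_cast
    ring
  simp only [e1, e2, tsum_mul_left] at h
  rw [auxT, ← pow_mul] at hT
  rw [hT] at h
  rw [phi, h, phi]
  ring

lemma aux_B (q : ℂ) (h0 : q ≠ 0) (hq : ‖q‖ < 1) :
    phi q ^ 2 = phi (q ^ 2) ^ 2 + 4 * q * psi (q ^ 4) ^ 2 := by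
  have h2 : ‖q ^ 2‖ < 1 := by rw [norm_pow]; exact pow_lt_one₀ (norm_nonneg q) hq (by norm_num)
  have h20 : q ^ 2 ≠ 0 := pow_ne_zero _ h0
  have hT := auxT_eq (q ^ 2) h2
  have s1 := aux_summable q hq
  have s2 := aux_summable (q ^ 2) h2
  have s3 := aux_summable_tri (q ^ 2) h2
  have p1 := tsum_mul_tsum_of_summable_norm s1 s1
  have p2 := tsum_mul_tsum_of_summable_norm s2 s2
  have p3 := tsum_mul_tsum_of_summable_norm s3 s3
  have h := aux_split _ (summable_mul_of_summable_norm s1 s1)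
    (fun z : ℤ × ℤ => (z.1 + z.2, z.1 - z.2)) (fun z : ℤ × ℤ => (z.1 + z.2 + 1, z.1 - z.2))
    (fun a b h => by simp only [Prod.mk.injEq] at h; ext <;> omega)
    (fun a b h => by simp only [Prod.mk.injEq] at h; ext <;> omega)
    (fun b c h => by simp only [Prod.mk.injEq] at h; omega)
    (fun a => by
      rcases Int.even_or_odd' (a.1 + a.2) with ⟨k, h | h⟩
      · exact Or.inl ⟨(k, a.1 - k), by ext <;> simp only <;> omega⟩
      · exact Or.inr ⟨(k, a.1 - k - 1), by ext <;> simp only <;> omega⟩)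
  have e1 : ∀ z : ℤ × ℤ, q ^ ((z.1 + z.2) ^ 2) * q ^ ((z.1 - z.2) ^ 2)
      = (q ^ 2) ^ (z.1 ^ 2) * (q ^ 2) ^ (z.2 ^ 2) := by
    intro z
    rw [← zpow_add₀ h0, ← zpow_add₀ h20, ← zpow_natCast q 2, ← zpow_mul]
    congr 1
    push_cast
    ring
  have e2 : ∀ z : ℤ × ℤ, q ^ ((z.1 + z.2 + 1) ^ 2) * q ^ ((z.1 - z.2) ^ 2)
      = q * ((q ^ 2) ^ (z.1 ^ 2 + z.1) * (q ^ 2) ^ (z.2 ^ 2 + z.2)) := by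
    intro z
    rw [← zpow_add₀ h0, ← zpow_add₀ h20, ← zpow_natCast q 2, ← zpow_mul, ← zpow_one_add₀ h0]
    congr 1
    push_cast
    ring
  simp only [e1, e2, tsum_mul_left] at h
  rw [← p1, ← p2, ← p3] at h
  rw [auxT, ← pow_mul] at hT
  rw [hT] at h
  rw [pow_two, phi, h, phi]
  ring

theorem stmt3 (q : ℂ) (hq : ‖q‖ < 1) :
    phi q ^ 2 = phi (q ^ 8) ^ 2 + 4 * q ^ 4 * psi (q ^ 16) ^ 2 + 4 * q ^ 2 * psi (q ^ 8) ^ 2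
      + 4 * q * phi (q ^ 16) * psi (q ^ 8) + 8 * q ^ 5 * psi (q ^ 8) * psi (q ^ 32) := by
  by_cases h0 : q = 0
  · subst h0
    simp
  have h4 : ‖q ^ 4‖ < 1 := by rw [norm_pow]; exact pow_lt_one₀ (norm_nonneg q) hq (by norm_num)
  have h40 : q ^ 4 ≠ 0 := pow_ne_zero _ h0
  have a1 := aux_A q h0 hq
  have a2 := aux_A (q ^ 4) h40 h4
  have b := aux_B (q ^ 4) h40 h4
  simp only [← pow_mul] at a2 b
  norm_num at a2 b
  rw [a1]
  linear_combination b + 4 * q * psi (q ^ 8) * a2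
end
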